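/- Let K be a finite pseudo-reflection group on ℝⁿ. For any λ ∈ ℂⁿ, the joint eigenspace E_λ = {f ∈ C^∞(ℝⁿ) : P(∂)f = P(λ)f for all P ∈ ℂ[x₁,…,xₙ]^K} satisfies dim E_λ ≤ |K|. More precisely, fixing any point x₀ ∈ ℝⁿ and a basis h₁,…,h_{|K|} of the harmonic polynomials H, the map f ↦ ((∂(h₁)f)(x₀),…,(∂(h_{|K|})f)(x₀)) is an injective linear map E_λ → ℂ^{|K|}. -/

import Mathlib

open Matrix MvPolynomial

noncomputable section

/-- The `i`-th partial derivative operator on functions `ℝⁿ → ℂ`. -/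
def pderivOp (n : ℕ) (i : Fin n) (f : (Fin n → ℝ) → ℂ) : (Fin n → ℝ) → ℂ :=
  fun x => fderiv ℝ f x (Pi.single i 1)

/-- The constant-coefficient differential operator `P(∂)` on functions `ℝⁿ → ℂ`. -/
def diffOp {n : ℕ} (P : MvPolynomial (Fin n) ℂ) (f : (Fin n → ℝ) → ℂ) : (Fin n → ℝ) → ℂ :=
  ∑ α ∈ P.support, P.coeff α •
    ((List.finRange n).foldr (fun i g => (pderivOp n i)^[α i] ∘ g) id) f

/-- Action of `g ∈ O(n)` on polynomials: `(g·P)(x) = P(g⁻¹x)`. -/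
def orthAct {n : ℕ} (g : Matrix.orthogonalGroup (Fin n) ℝ) :
    MvPolynomial (Fin n) ℂ →ₐ[ℂ] MvPolynomial (Fin n) ℂ :=
  aeval (fun i => ∑ j, (((((g⁻¹ : Matrix.orthogonalGroup (Fin n) ℝ) :
    Matrix (Fin n) (Fin n) ℝ) i j : ℝ) : ℂ)) • (X j : MvPolynomial (Fin n) ℂ))

/-- The joint eigenspace `E_λ ⊆ C^∞(ℝⁿ)`: smooth `f` with `P(∂)f = P(λ)f` for every
`K`-invariant polynomial `P`. -/
def eigenSet {n : ℕ} (K : Subgroup (Matrix.orthogonalGroup (Fin n) ℝ))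
    (lam : Fin n → ℂ) : Set ((Fin n → ℝ) → ℂ) :=
  {f | ContDiff ℝ (⊤ : ℕ∞) f ∧ ∀ P : MvPolynomial (Fin n) ℂ,
    (∀ g ∈ K, orthAct g P = P) → diffOp P f = fun x => MvPolynomial.eval lam P * f x}

theorem exists_hom {n : ℕ} {A : Type*} [Ring A] [Algebra ℂ A] (a : Fin n → A)
    (hc : ∀ i j, a i * a j = a j * a i) :
    ∃ φ : MvPolynomial (Fin n) ℂ →ₐ[ℂ] A, ∀ i, φ (X i) = a i := by
  let _ : CommRing (Algebra.adjoin ℂ (Set.range a)) :=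
    Algebra.adjoinCommRingOfComm ℂ (by rintro _ ⟨i, rfl⟩ _ ⟨j, rfl⟩; exact hc i j)
  refine ⟨(Algebra.adjoin ℂ (Set.range a)).val.comp
    (aeval (fun i => ⟨a i, Algebra.subset_adjoin ⟨i, rfl⟩⟩)), ?_⟩
  intro i
  simp

theorem hom_eq {n : ℕ} {A : Type*} [Ring A] [Algebra ℂ A] (a : Fin n → A)
    (φ : MvPolynomial (Fin n) ℂ →ₐ[ℂ] A) (h : ∀ i, φ (X i) = a i) (P : MvPolynomial (Fin n) ℂ) :
    φ P = ∑ α ∈ P.support, P.coeff α •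
      ((List.finRange n).foldr (fun j E => a j ^ (α j) * E) 1) := by
  conv_lhs => rw [P.as_sum]
  rw [map_sum]
  refine Finset.sum_congr rfl fun α _ => ?_
  have : monomial α (P.coeff α) = P.coeff α • ((List.finRange n).map fun j => (X j : MvPolynomial (Fin n) ℂ) ^ α j).prod := by
    rw [← List.ofFn_eq_map, List.prod_ofFn, monomial_eq, smul_eq_C_mul, Finsupp.prod_fintype _ _ (by simp)]
  rw [this, map_smul, map_list_prod, List.map_map, List.prod_eq_foldr, List.foldr_map]
  simp [h]

theorem pd_comm {n : ℕ} (i j : Fin n) :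
    ((MvPolynomial.pderiv i).toLinearMap : Module.End ℂ (MvPolynomial (Fin n) ℂ)) * (MvPolynomial.pderiv j).toLinearMap
    = (MvPolynomial.pderiv j).toLinearMap * (MvPolynomial.pderiv i).toLinearMap := by
  ext1 m
  ext d
  by_cases h : i = j
  · subst h; rfl
  · have h' : ¬ j = i := fun e => h e.symm
    simp [coeff_pderiv, h, h', add_right_comm]
    ring

section alg
variable {n : ℕ} (ψ : MvPolynomial (Fin n) ℂ →ₐ[ℂ] Module.End ℂ (MvPolynomial (Fin n) ℂ))

theorem psi_mono (hψ : ∀ i, ψ (X i) = (MvPolynomial.pderiv i).toLinearMap)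
    (α : Fin n →₀ ℕ) : ∀ β : Fin n →₀ ℕ, ∃ c : ℕ, 0 < c ∧ ∀ Q,
    coeff β (ψ (monomial α 1) Q) = c * coeff (β + α) Q := by
  induction α using Finsupp.induction_linear with
  | zero => intro β; exact ⟨1, by simp, fun Q => by
      have : (monomial (0 : Fin n →₀ ℕ)) (1 : ℂ) = 1 := rfl
      rw [this]; simp⟩
  | add a b ha hb =>
    intro β
    obtain ⟨c, hc, h1⟩ := ha β
    obtain ⟨c', hc', h2⟩ := hb (β + a)
    refine ⟨c * c', by positivity, fun Q => ?_⟩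
    have : (monomial (a + b)) (1 : ℂ) = monomial a 1 * monomial b 1 := by simp [monomial_mul]
    rw [this, map_mul, Module.End.mul_apply, h1, h2]
    push_cast; rw [add_assoc]; ring
  | single i k =>
    induction k with
    | zero => intro β; exact ⟨1, by simp, fun Q => by
        have : (monomial (Finsupp.single i 0)) (1 : ℂ) = 1 := by simp
        rw [this]; simp⟩
    | succ k ih =>
      intro β
      obtain ⟨c, hc, h1⟩ := ih (β + Finsupp.single i 1)
      refine ⟨(β i + 1) * c, by positivity, fun Q => ?_⟩
      have : (monomial (Finsupp.single i (k+1))) (1 : ℂ) = X i * monomial (Finsupp.single i k) 1 := by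
        simp [X, monomial_mul, add_comm]
      rw [this, map_mul, Module.End.mul_apply, hψ]
      simp only [Derivation.coeFn_coe, coeff_pderiv]
      rw [h1, add_assoc, ← Finsupp.single_add, add_comm 1 k]
      push_cast; ring

/-- The nondegeneracy. -/
theorem psi_nondeg (hψ : ∀ i, ψ (X i) = (MvPolynomial.pderiv i).toLinearMap)
    (Q : MvPolynomial (Fin n) ℂ)
    (h : ∀ α, coeff 0 (ψ (monomial α 1) Q) = 0) : Q = 0 := by
  ext α
  obtain ⟨c, hc, h1⟩ := psi_mono ψ hψ α 0
  have := h α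
  rw [h1] at this
  simpa [hc.ne'] using this

theorem psi_pos (hψ : ∀ i, ψ (X i) = (MvPolynomial.pderiv i).toLinearMap)
    (Q : MvPolynomial (Fin n) ℂ)
    (h : coeff 0 (ψ (MvPolynomial.map (starRingEnd ℂ) Q) Q) = 0) : Q = 0 := by
  choose c hc h1 using fun α => psi_mono ψ hψ α 0
  have e : coeff 0 (ψ (MvPolynomial.map (starRingEnd ℂ) Q) Q)
      = ((∑ α ∈ Q.support, (c α : ℝ) * ‖coeff α Q‖ ^ 2 : ℝ) : ℂ) := by
    have : MvPolynomial.map (starRingEnd ℂ) Q = ∑ α ∈ Q.support, (starRingEnd ℂ (coeff α Q)) • monomial α (1 : ℂ) := by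
      conv_lhs => rw [Q.as_sum]
      simp only [map_sum, map_monomial, smul_monomial, smul_eq_mul, mul_one]
    rw [this, map_sum, LinearMap.sum_apply, coeff_sum]
    push_cast
    refine Finset.sum_congr rfl fun α _ => ?_
    rw [map_smul, LinearMap.smul_apply, coeff_smul, h1, zero_add, smul_eq_mul, ← Complex.conj_mul']
    ring
  rw [e, Complex.ofReal_eq_zero, Finset.sum_eq_zero_iff_of_nonneg (fun _ _ => by positivity)] at h
  ext α
  by_contra hne
  have := h α (by simpa using hne)
  have := hc α
  simp_all

theorem psi_deg (hψ : ∀ i, ψ (X i) = (MvPolynomial.pderiv i).toLinearMap)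
    {d e : ℕ} (hde : d ≠ e) (P Q : MvPolynomial (Fin n) ℂ) (hP : P.IsHomogeneous d)
    (hQ : Q.IsHomogeneous e) : coeff 0 (ψ P Q) = 0 := by
  rw [P.as_sum, map_sum, LinearMap.sum_apply, coeff_sum]
  refine Finset.sum_eq_zero fun α hα => ?_
  obtain ⟨c, hc, h1⟩ := psi_mono ψ hψ α 0
  have : monomial α (coeff α P) = coeff α P • monomial α (1 : ℂ) := by simp [smul_monomial]
  rw [this, map_smul, LinearMap.smul_apply, coeff_smul, h1, zero_add]
  have h2 : coeff α Q = 0 := by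
    apply hQ.coeff_eq_zero
    have h3 : Finsupp.degree α = d := by
      by_contra hh
      exact (by simpa using hα : coeff α P ≠ 0) (hP.coeff_eq_zero hh)
    omega
  simp [h2]

theorem key (hψ : ∀ i, ψ (X i) = (MvPolynomial.pderiv i).toLinearMap)
    (Inv : Set (MvPolynomial (Fin n) ℂ))
    (hconj : ∀ P ∈ Inv, MvPolynomial.map (starRingEnd ℂ) P ∈ Inv)
    (hhc : ∀ P ∈ Inv, ∀ e, homogeneousComponent e P ∈ Inv)
    (N : Submodule ℂ (MvPolynomial (Fin n) ℂ))
    (hH : ∀ q, (∀ P ∈ Inv, coeff 0 P = 0 → ψ P q = 0) → q ∈ N)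
    (hI : ∀ P ∈ Inv, ∀ R ∈ N, P * R ∈ N) : N = ⊤ := by
  have main : ∀ d (Q : MvPolynomial (Fin n) ℂ), Q.IsHomogeneous d → Q ∈ N := by
    intro d
    induction d using Nat.strong_induction_on with
    | _ d ih =>
    intro Q hQ
    set G : Set (MvPolynomial (Fin n) ℂ) := {r | ∃ (e k : ℕ) (P R : MvPolynomial (Fin n) ℂ), 0 < e ∧ e + k = d ∧
      P ∈ Inv ∧ P.IsHomogeneous e ∧ R.IsHomogeneous k ∧ r = P * R} with hG
    set J := Submodule.span ℂ G with hJ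
    have hJN : J ≤ N := by
      refine Submodule.span_le.2 ?_
      rintro _ ⟨e, k, P, R, he, hk, hP, hPe, hR, rfl⟩
      exact hI P hP R (ih k (by omega) R hR)
    have hJU : J ≤ homogeneousSubmodule (Fin n) ℂ d := by
      refine Submodule.span_le.2 ?_
      rintro _ ⟨e, k, P, R, he, hk, hP, hPe, hR, rfl⟩
      exact hk ▸ hPe.mul hR
    have hJc : ∀ r ∈ J, MvPolynomial.map (starRingEnd ℂ) r ∈ J := by
      intro r hr
      induction hr using Submodule.span_induction with
      | mem x hx =>
        obtain ⟨e, k, P, R, he, hk, hP, hPe, hR, rfl⟩ := hx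
        exact Submodule.subset_span ⟨e, k, _, _, he, hk, hconj P hP, hPe.map _, hR.map (starRingEnd ℂ), map_mul _ _ _⟩
      | zero => simp
      | add x y _ _ hx hy => rw [map_add]; exact J.add_mem hx hy
      | smul a x _ hx =>
        rw [smul_eq_C_mul, map_mul, map_C, ← smul_eq_C_mul]; exact J.smul_mem _ hx
    have : FiniteDimensional ℂ J := by
      have : FiniteDimensional ℂ (restrictTotalDegree (Fin n) ℂ d) := inferInstance
      refine Submodule.finiteDimensional_of_le (S₂ := restrictTotalDegree (Fin n) ℂ d) ?_
      intro r hr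
      rw [mem_restrictTotalDegree]
      exact IsHomogeneous.totalDegree_le (hJU hr)
    -- the map J → Dual J
    let B : MvPolynomial (Fin n) ℂ →ₗ[ℂ] Module.Dual ℂ J :=
      LinearMap.mk₂ ℂ (fun q (r : J) => coeff 0 (ψ r.1 q))
        (by simp) (by simp) (by simp) (by simp)
    have hinj : Function.Injective (B ∘ₗ J.subtype) := by
      rw [← LinearMap.ker_eq_bot, LinearMap.ker_eq_bot']
      intro j hj
      have := LinearMap.congr_fun hj ⟨_, hJc j.1 j.2⟩
      exact Subtype.ext (psi_pos ψ hψ j.1 this)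
    have hsurj := (LinearMap.injective_iff_surjective_of_finrank_eq_finrank
      (Subspace.dual_finrank_eq (K := ℂ) (V := J)).symm).1 hinj
    obtain ⟨j, hj⟩ := hsurj (B Q)
    have hq : ∀ r ∈ J, coeff 0 (ψ r (Q - j)) = 0 := by
      intro r hr
      have := LinearMap.congr_fun hj ⟨r, hr⟩
      have : coeff 0 (ψ r j) = coeff 0 (ψ r Q) := this
      simp [this]
    have hqd : (Q - j.1).IsHomogeneous d := hQ.sub (hJU j.2)
    have : Q - j ∈ N := by
      apply hH
      intro P hP hP0
      apply psi_nondeg ψ hψ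
      intro α
      rw [← Module.End.mul_apply, ← map_mul, ← sum_homogeneousComponent P, Finset.mul_sum, map_sum,
        LinearMap.sum_apply, coeff_sum]
      refine Finset.sum_eq_zero fun e _ => ?_
      have h1 : (monomial α (1 : ℂ) * homogeneousComponent e P).IsHomogeneous (Finsupp.degree α + e) :=
        (isHomogeneous_monomial _ rfl).mul (homogeneousComponent_isHomogeneous e P)
      by_cases hd : Finsupp.degree α + e = d
      · rcases Nat.eq_zero_or_pos e with rfl | he
        · simp [homogeneousComponent_zero, hP0]
        · exact hq _ (Submodule.subset_span ⟨e, _, _, _, he, by omega, hhc P hP e,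
            homogeneousComponent_isHomogeneous e P, isHomogeneous_monomial _ rfl, mul_comm _ _⟩)
      · exact psi_deg ψ hψ hd _ _ h1 hqd
    have := N.add_mem this (hJN j.2)
    simpa using this
  rw [eq_top_iff]
  intro Q _
  rw [← sum_homogeneousComponent Q]
  exact N.sum_mem fun e _ => main e _ (homogeneousComponent_isHomogeneous e Q)
end alg

/-- Smooth functions. -/
def Sm (n : ℕ) : Submodule ℂ ((Fin n → ℝ) → ℂ) where
  carrier := {f | ContDiff ℝ (⊤ : ℕ∞) f}
  add_mem' := by
    intro a b ha hb
    rw [Set.mem_setOf_eq] at *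
    exact ha.add hb
  zero_mem' := by
    rw [Set.mem_setOf_eq]
    exact contDiff_const
  smul_mem' := by
    intro c f hf
    rw [Set.mem_setOf_eq] at *
    exact hf.const_smul c

theorem pderivOp_smooth {n : ℕ} (i : Fin n) (f : (Fin n → ℝ) → ℂ) (hf : f ∈ Sm n) :
    pderivOp n i f ∈ Sm n := by
  have hf' : ContDiff ℝ (⊤ : ℕ∞) f := hf
  have : ContDiff ℝ (⊤ : ℕ∞) (fderiv ℝ f) := hf'.fderiv_right (by simp)
  exact this.clm_apply contDiff_const

theorem Sm.diff {n : ℕ} {f : (Fin n → ℝ) → ℂ} (hf : f ∈ Sm n) : Differentiable ℝ f :=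
  ContDiff.differentiable (n := (⊤ : ℕ∞)) hf (by simp)

/-- Partial derivative on smooth functions. -/
def dS (n : ℕ) (i : Fin n) : Module.End ℂ (Sm n) where
  toFun f := ⟨pderivOp n i f.1, pderivOp_smooth i f.1 f.2⟩
  map_add' f g := by
    ext x
    simp only [pderivOp, Submodule.coe_add, Pi.add_apply]
    rw [fderiv_add (Sm.diff f.2 x) (Sm.diff g.2 x)]
    rfl
  map_smul' c f := by
    ext x
    simp only [pderivOp, Submodule.coe_smul, Pi.smul_apply, RingHom.id_apply]
    rw [fderiv_const_smul (Sm.diff f.2 x)]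
    rfl

theorem dS_comm (n : ℕ) (i j : Fin n) : dS n i * dS n j = dS n j * dS n i := by
  ext f x
  have hf' : ContDiff ℝ (⊤ : ℕ∞) f.1 := f.2
  have h1 : ContDiff ℝ (⊤ : ℕ∞) (fderiv ℝ f.1) := hf'.fderiv_right (by simp)
  have h2 : DifferentiableAt ℝ (fderiv ℝ f.1) x := (h1.differentiable (by simp)) x
  have hs : IsSymmSndFDerivAt ℝ f.1 x := by
    refine (hf'.contDiffAt (x := x)).isSymmSndFDerivAt ?_
    simp only [minSmoothness_of_isRCLikeNormedField]
    exact WithTop.coe_le_coe.2 (le_top : (2 : ℕ∞) ≤ ⊤)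
  have e : ∀ v w, fderiv ℝ (fun y => fderiv ℝ f.1 y v) x w = fderiv ℝ (fderiv ℝ f.1) x w v := by
    intro v w
    rw [fderiv_clm_apply h2 (by fun_prop)]
    simp
  change fderiv ℝ (fun y => fderiv ℝ f.1 y (Pi.single j 1)) x (Pi.single i 1)
    = fderiv ℝ (fun y => fderiv ℝ f.1 y (Pi.single i 1)) x (Pi.single j 1)
  rw [e, e]
  exact hs.eq _ _

theorem dS_pow (n : ℕ) (i : Fin n) (k : ℕ) (f : Sm n) :
    ((dS n i ^ k) f).1 = (pderivOp n i)^[k] f.1 := by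
  induction k with
  | zero => rfl
  | succ k ih => rw [pow_succ', Function.iterate_succ_apply', ← ih]; rfl

theorem dS_foldr (n : ℕ) (α : Fin n → ℕ) (l : List (Fin n)) (f : Sm n) :
    ((l.foldr (fun j E => dS n j ^ (α j) * E) 1 : Module.End ℂ (Sm n)) f).1 =
    (l.foldr (fun i g => (pderivOp n i)^[α i] ∘ g) id) f.1 := by
  induction l with
  | nil => rfl
  | cons a l ih =>
    simp only [List.foldr_cons, Function.comp_apply, Module.End.mul_apply]
    rw [dS_pow, ih]

theorem diffOp_eq {n : ℕ} (φ : MvPolynomial (Fin n) ℂ →ₐ[ℂ] Module.End ℂ (Sm n))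
    (h : ∀ P, φ P = ∑ α ∈ P.support, P.coeff α •
      ((List.finRange n).foldr (fun j E => dS n j ^ (α j) * E) 1))
    (P : MvPolynomial (Fin n) ℂ) (f : Sm n) : (φ P f).1 = diffOp P f.1 := by
  rw [h, diffOp, LinearMap.sum_apply, Submodule.coe_sum]
  refine Finset.sum_congr rfl fun α _ => ?_
  rw [LinearMap.smul_apply, Submodule.coe_smul, dS_foldr]

theorem ode {m : ℕ} (A : Fin m → Fin m → ℂ) (u : ℝ → Fin m → ℂ)
    (hu : ∀ t i, HasDerivAt (fun s => u s i) (∑ j, A i j * u t j) t) (h0 : u 0 = 0) : u = 0 := by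
  let L : (Fin m → ℂ) →L[ℂ] (Fin m → ℂ) := LinearMap.toContinuousLinearMap (Matrix.mulVecLin (Matrix.of A))
  have hL : ∀ w i, L w i = ∑ j, A i j * w j := fun w i => rfl
  refine ODE_solution_unique_univ (v := fun _ => L) (s := fun _ => Set.univ) (K := ‖L‖₊) (t₀ := 0)
    (fun t => L.lipschitz.lipschitzOnWith) (fun t => ⟨?_, trivial⟩) (fun t => ⟨?_, trivial⟩) h0
  · rw [hasDerivAt_pi]; exact hu t
  · simp

theorem line_deriv {n : ℕ} (f : Sm n) (x v : Fin n → ℝ) (t : ℝ) :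
    HasDerivAt (fun s : ℝ => f.1 (x + s • v)) (∑ k, (v k : ℂ) * (dS n k f).1 (x + t • v)) t := by
  have h1 := (Sm.diff f.2 (x + t • v)).hasFDerivAt
  have h2 : HasDerivAt (fun s : ℝ => x + s • v) v t := by
    simpa using ((hasDerivAt_id t).smul_const v).const_add x
  have := h1.comp_hasDerivAt t h2
  refine this.congr_deriv ?_
  have e : ∀ T : (Fin n → ℝ) →L[ℝ] ℂ, T v = ∑ k, (v k : ℂ) * T (Pi.single k 1) := by
    intro T
    conv_lhs => rw [pi_eq_sum_univ' v, map_sum]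
    refine Finset.sum_congr rfl fun k _ => ?_
    rw [map_smul, Complex.real_smul]
  exact e _

theorem inj_core {n m : ℕ} (φ : MvPolynomial (Fin n) ℂ →ₐ[ℂ] Module.End ℂ (Sm n))
    (hφ : ∀ i, φ (X i) = dS n i) (h : Fin m → MvPolynomial (Fin n) ℂ) (f : Sm n)
    (x₀ : Fin n → ℝ)
    (hN : ∀ Q, φ Q f ∈ Submodule.span ℂ (Set.range fun i => φ (h i) f))
    (h0 : ∀ i, (φ (h i) f).1 x₀ = 0) : f = 0 := by
  have hN' : ∀ Q, ∃ c : Fin m → ℂ, ∑ j, c j • φ (h j) f = φ Q f := fun Q =>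
    (Submodule.mem_span_range_iff_exists_fun ℂ).1 (hN Q)
  ext y
  set v := y - x₀
  choose A hA using fun i => hN' ((∑ k, C (v k : ℂ) * X k) * h i)
  have hz := ode A (fun t i => (φ (h i) f).1 (x₀ + t • v)) (by
    intro t i
    refine (line_deriv (φ (h i) f) x₀ v t).congr_deriv ?_
    have := congrArg (fun g : Sm n => g.1 (x₀ + t • v)) (hA i)
    simp only [Submodule.coe_sum, Submodule.coe_smul, Finset.sum_apply, Pi.smul_apply, smul_eq_mul] at this
    rw [this, map_mul, map_sum, Module.End.mul_apply, LinearMap.sum_apply, Submodule.coe_sum,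
      Finset.sum_apply]
    refine Finset.sum_congr rfl fun k _ => ?_
    rw [← smul_eq_C_mul, map_smul, hφ]
    rfl) (by ext i; simp [h0])
  obtain ⟨c, hc⟩ := hN' 1
  rw [map_one, Module.End.one_apply] at hc
  rw [← hc]
  simp only [Submodule.coe_sum, Submodule.coe_smul, Finset.sum_apply, Pi.smul_apply, smul_eq_mul]
  refine Finset.sum_eq_zero fun j _ => ?_
  have := congrFun (congrFun hz 1) j
  simp only [one_smul, Pi.zero_apply] at this
  have e : x₀ + v = y := by simp [v]
  rw [e] at this
  rw [this, mul_zero]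

theorem orthAct_conj {n : ℕ} (g : Matrix.orthogonalGroup (Fin n) ℝ) (P : MvPolynomial (Fin n) ℂ) :
    orthAct g (MvPolynomial.map (starRingEnd ℂ) P) = MvPolynomial.map (starRingEnd ℂ) (orthAct g P) := by
  induction P using MvPolynomial.induction_on with
  | C a => simp [orthAct]
  | add p q hp hq => simp [hp, hq]
  | mul_X p i hp =>
    rw [map_mul, map_mul, map_mul, map_mul, hp]
    congr 1
    simp only [orthAct, map_X, aeval_X, map_sum, smul_eq_C_mul, map_mul, map_C, Complex.conj_ofReal]

theorem orthAct_hom {n : ℕ} (g : Matrix.orthogonalGroup (Fin n) ℝ) (P : MvPolynomial (Fin n) ℂ) (e : ℕ)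
    (hP : P.IsHomogeneous e) : (orthAct g P).IsHomogeneous e := by
  have := hP.aeval (n := 1) (fun i => ∑ j, (((((g⁻¹ : Matrix.orthogonalGroup (Fin n) ℝ) :
    Matrix (Fin n) (Fin n) ℝ) i j : ℝ) : ℂ)) • (X j : MvPolynomial (Fin n) ℂ)) (by
      intro i
      refine IsHomogeneous.sum _ _ _ fun j _ => ?_
      rw [smul_eq_C_mul]
      simpa using (isHomogeneous_C _ _).mul (isHomogeneous_X ℂ j))
  simpa [orthAct] using this

theorem orthAct_hc {n : ℕ} (g : Matrix.orthogonalGroup (Fin n) ℝ) (P : MvPolynomial (Fin n) ℂ) (e : ℕ) :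
    orthAct g (homogeneousComponent e P) = homogeneousComponent e (orthAct g P) := by
  conv_rhs => rw [← sum_homogeneousComponent P, map_sum, map_sum]
  have : ∀ i, homogeneousComponent e (orthAct g (homogeneousComponent i P)) =
     if e = i then orthAct g (homogeneousComponent i P) else 0 := fun i =>
    homogeneousComponent_of_mem (orthAct_hom g _ i (homogeneousComponent_isHomogeneous i P))
  simp only [this, Finset.sum_ite_eq]
  split_ifs with h
  · rfl
  · rw [Finset.mem_range, not_lt] at h
    rw [homogeneousComponent_eq_zero _ _ (by omega), map_zero]

/-- For a finite pseudo-reflection group `K ≤ O(n)` and any `λ ∈ ℂⁿ`,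
`dim E_λ ≤ |K|`: fixing `x₀ ∈ ℝⁿ` and a basis `h₁,…,h_{|K|}` of the `|K|`-dimensional
space `H` of `K`-harmonic polynomials, `f ↦ ((∂(h₁)f)(x₀),…,(∂(h_{|K|})f)(x₀))` is an
injective linear map `E_λ → ℂ^{|K|}`; in particular any linearly independent family in
`E_λ` has at most `|K|` members. -/
theorem stmt14 (n : ℕ) (K : Subgroup (Matrix.orthogonalGroup (Fin n) ℝ)) [Finite K]
    (hrefl : K = Subgroup.closure
      {g : Matrix.orthogonalGroup (Fin n) ℝ | g ∈ K ∧ ∃ c : ℂ, c ≠ 1 ∧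
        ((g : Matrix (Fin n) (Fin n) ℝ).map (Complex.ofReal)).charpoly
          = (Polynomial.X - Polynomial.C c) * (Polynomial.X - 1) ^ (n - 1)})
    (lam : Fin n → ℂ) (x₀ : Fin n → ℝ)
    (h : Fin (Nat.card K) → MvPolynomial (Fin n) ℂ)
    (hharm : ∀ i, ∀ P : MvPolynomial (Fin n) ℂ, (∀ g ∈ K, orthAct g P = P) →
      P.coeff 0 = 0 →
      (∑ α ∈ P.support, P.coeff α •
        ((List.finRange n).foldr
          (fun j E => (((MvPolynomial.pderiv j).toLinearMap :
            Module.End ℂ (MvPolynomial (Fin n) ℂ)) ^ (α j)) * E) 1)) (h i) = 0)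
    (hindep : LinearIndependent ℂ h)
    (hspan : ∀ q : MvPolynomial (Fin n) ℂ,
      (∀ P : MvPolynomial (Fin n) ℂ, (∀ g ∈ K, orthAct g P = P) → P.coeff 0 = 0 →
        (∑ α ∈ P.support, P.coeff α •
          ((List.finRange n).foldr
            (fun j E => (((MvPolynomial.pderiv j).toLinearMap :
              Module.End ℂ (MvPolynomial (Fin n) ℂ)) ^ (α j)) * E) 1)) q = 0) →
      q ∈ Submodule.span ℂ (Set.range h)) :
    (∀ f₁ ∈ eigenSet K lam, ∀ f₂ ∈ eigenSet K lam,
      (∀ i, diffOp (h i) f₁ x₀ = diffOp (h i) f₂ x₀) → f₁ = f₂) ∧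
    (∀ (m : ℕ) (F : Fin m → ((Fin n → ℝ) → ℂ)),
      (∀ i, F i ∈ eigenSet K lam) → LinearIndependent ℂ F → m ≤ Nat.card K) := by
  classical
  obtain ⟨φ, hφ⟩ := exists_hom (dS n) (dS_comm n)
  have hφ' := hom_eq (dS n) φ hφ
  have hD := diffOp_eq φ hφ'
  obtain ⟨ψ, hψ⟩ := exists_hom
    (fun j : Fin n => ((MvPolynomial.pderiv j).toLinearMap : Module.End ℂ (MvPolynomial (Fin n) ℂ))) pd_comm
  have hψ' := hom_eq _ ψ hψ
  have inj : ∀ f : Sm n, (∀ P : MvPolynomial (Fin n) ℂ, (∀ g ∈ K, orthAct g P = P) →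
      φ P f = MvPolynomial.eval lam P • f) → (∀ i, (φ (h i) f).1 x₀ = 0) → f = 0 := by
    intro f hf h0
    refine inj_core φ hφ h f x₀ ?_ h0
    have hN := key ψ hψ {P | ∀ g ∈ K, orthAct g P = P}
      (fun P hP g hg => by rw [orthAct_conj, hP g hg])
      (fun P hP e g hg => by rw [orthAct_hc, hP g hg])
      ((Submodule.span ℂ (Set.range fun i => φ (h i) f)).comap
        (LinearMap.applyₗ f ∘ₗ φ.toLinearMap)) ?_ ?_
    · intro Q
      have : Q ∈ (⊤ : Submodule ℂ (MvPolynomial (Fin n) ℂ)) := trivial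
      rw [← hN] at this
      exact this
    · intro q hq
      have hq' := hspan q fun P hP hP0 => by rw [← hψ']; exact hq P hP hP0
      refine (Submodule.span_le.2 ?_ : Submodule.span ℂ (Set.range h) ≤ _) hq'
      rintro _ ⟨i, rfl⟩
      exact Submodule.subset_span ⟨i, rfl⟩
    · intro P hP R hR
      have hR' : φ R f ∈ Submodule.span ℂ (Set.range fun i => φ (h i) f) := hR
      change φ (P * R) f ∈ Submodule.span ℂ (Set.range fun i => φ (h i) f)
      rw [mul_comm, map_mul, Module.End.mul_apply, hf P hP, map_smul]
      exact Submodule.smul_mem _ _ hR'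
  have eig : ∀ f (hf : f ∈ eigenSet K lam), ∀ P : MvPolynomial (Fin n) ℂ,
      (∀ g ∈ K, orthAct g P = P) → φ P ⟨f, hf.1⟩ = MvPolynomial.eval lam P • ⟨f, hf.1⟩ := by
    intro f hf P hP
    apply Subtype.ext
    rw [hD, hf.2 P hP]
    rfl
  refine ⟨?_, ?_⟩
  · intro f₁ h₁ f₂ h₂ heq
    have := inj (⟨f₁, h₁.1⟩ - ⟨f₂, h₂.1⟩) (fun P hP => by
      rw [map_sub, eig f₁ h₁ P hP, eig f₂ h₂ P hP, smul_sub]) (fun i => by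
      rw [map_sub, Submodule.coe_sub, Pi.sub_apply, hD, hD, heq i, sub_self])
    exact congrArg Subtype.val (sub_eq_zero.1 this)
  · intro m F hF hli
    let G : Fin m → Sm n := fun i => ⟨F i, (hF i).1⟩
    have hG : LinearIndependent ℂ G := LinearIndependent.of_comp (Sm n).subtype hli
    let T : (Fin m → ℂ) →ₗ[ℂ] (Fin (Nat.card K) → ℂ) :=
      LinearMap.pi (fun i => LinearMap.proj x₀ ∘ₗ (Sm n).subtype ∘ₗ φ (h i)) ∘ₗ
        Fintype.linearCombination ℂ G
    have hT : Function.Injective T := by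
      rw [← LinearMap.ker_eq_bot, LinearMap.ker_eq_bot']
      intro c hc
      have h1 : Fintype.linearCombination ℂ G c = 0 := by
        refine inj _ (fun P hP => ?_) (fun i => congrFun hc i)
        rw [Fintype.linearCombination_apply, map_sum, Finset.smul_sum]
        refine Finset.sum_congr rfl fun i _ => ?_
        rw [map_smul, smul_comm, eig (F i) (hF i) P hP]
      rw [Fintype.linearCombination_apply] at h1
      ext i
      exact Fintype.linearIndependent_iff.1 hG c h1 i
    simpa using LinearMap.finrank_le_finrank_of_injective hT

end
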